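/- End-to-end correctness of the privacy-preserving n-party summation protocol: let p ≥ 2, n ≥ 2 be integers and P ∈ ℕ a precision. Let m_1, …, m_n ∈ ℚ be the agents' secret values with 10^P · m_i ∈ ℤ for every i and |10^P · (m_1 + ⋯ + m_n)| < p/2. Suppose each agent i encodes s_i = enc(m_i) ∈ ZMod p and splits it into any additive secret sharing (r_{i,1}, …, r_{i,n}) with r_{i,1} + ⋯ + r_{i,n} = s_i; each agent j then broadcasts b_j = r_{1,j} + ⋯ + r_{n,j}. Then decoding the sum of the broadcasts recovers the exact sum of the secret values: dec(b_1 + ⋯ + b_n) = m_1 + ⋯ + m_n. -/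

import Mathlib

/-- The fixed-point encoding `enc(x) = int(10^P · x) mod p` into `ZMod p`. -/
noncomputable def enc (p P : ℕ) (x : ℝ) : ZMod p :=
  ((⌊(10 : ℝ) ^ P * x⌋ : ℤ) : ZMod p)

/-- The decoding `dec(z) = v / 10^P` if `v ≤ p/2` and `(v - p) / 10^P`
otherwise, where `v ∈ {0, …, p-1}` is the canonical representative of `z`. -/
noncomputable def dec (p P : ℕ) (z : ZMod p) : ℝ :=
  if (z.val : ℝ) ≤ (p : ℝ) / 2 then (z.val : ℝ) / 10 ^ P
  else ((z.val : ℝ) - (p : ℝ)) / 10 ^ P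

theorem enc_of_mul_eq_intCast {p P : ℕ} {x : ℝ} {k : ℤ} (h : (10 : ℝ) ^ P * x = k) :
    enc p P x = (k : ZMod p) := by
  rw [enc, h, Int.floor_intCast]

theorem dec_intCast {p : ℕ} (P : ℕ) {k : ℤ} (h : 2 * |k| < p) :
    dec p P (k : ZMod p) = (k : ℝ) / 10 ^ P := by
  have : NeZero p := ⟨by rintro rfl; have := abs_nonneg k; push_cast at h; omega⟩
  have hval : (((k : ZMod p).val : ℕ) : ℤ) = k % p := ZMod.val_intCast k
  obtain ⟨h₁, h₂⟩ := abs_lt.mp (show |k| < p by have := abs_nonneg k; omega)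
  rw [dec]
  rcases le_or_gt 0 k with hk | hk
  · rw [Int.emod_eq_of_lt hk h₂] at hval
    rw [abs_of_nonneg hk] at h
    have hv : ((k : ZMod p).val : ℝ) = k := by exact_mod_cast hval
    have hr : 2 * (k : ℝ) < p := by exact_mod_cast h
    rw [hv, if_pos (by linarith)]
  · rw [← Int.add_emod_right, Int.emod_eq_of_lt (by omega) (by omega)] at hval
    rw [abs_of_neg hk] at h
    have hv : ((k : ZMod p).val : ℝ) = k + p := by exact_mod_cast hval
    have hr : 2 * -(k : ℝ) < p := by exact_mod_cast h
    rw [hv, if_neg (by linarith), add_sub_cancel_right]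

/-- **End-to-end correctness of the privacy-preserving `n`-party summation
protocol.** Let `p ≥ 2`, `n ≥ 2`, and `P` a precision. Let `m 0, …, m (n-1) : ℚ`
be the agents' secret values, each `10^P · m i` an integer, with
`|10^P · (m 0 + ⋯ + m (n-1))| < p/2`. Each agent `i` encodes its value as
`enc (m i)` and splits it into any additive secret sharing
`(r i 0, …, r i (n-1))` with `∑ j, r i j = enc (m i)`; each agent `j`
broadcasts `b j = ∑ i, r i j`. Then decoding the sum of the broadcasts
recovers the exact sum of the secret values:
`dec (b 0 + ⋯ + b (n-1)) = m 0 + ⋯ + m (n-1)`. -/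
theorem private_summation_protocol_correct
    (p n P : ℕ) (hp : 2 ≤ p) (hn : 2 ≤ n)
    (m : Fin n → ℚ)
    (hint : ∀ i : Fin n, ∃ k : ℤ, (10 : ℚ) ^ P * m i = (k : ℚ))
    (hbound : |(10 : ℚ) ^ P * ∑ i : Fin n, m i| < (p : ℚ) / 2)
    (r : Fin n → Fin n → ZMod p)
    (hshare : ∀ i : Fin n, ∑ j : Fin n, r i j = enc p P ((m i : ℚ) : ℝ))
    (b : Fin n → ZMod p) (hb : ∀ j : Fin n, b j = ∑ i : Fin n, r i j) :
    dec p P (∑ j : Fin n, b j) = ((∑ i : Fin n, m i : ℚ) : ℝ) := by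
  choose k hk using hint
  have hsum : (10 : ℚ) ^ P * ∑ i, m i = ((∑ i, k i : ℤ) : ℚ) := by
    rw [Finset.mul_sum, Int.cast_sum]
    exact Finset.sum_congr rfl fun i _ => hk i
  have hbroadcast : ∑ j, b j = ((∑ i, k i : ℤ) : ZMod p) := by
    simp_rw [hb]
    rw [Finset.sum_comm, Int.cast_sum]
    refine Finset.sum_congr rfl fun i _ => ?_
    rw [hshare]
    exact enc_of_mul_eq_intCast (by exact_mod_cast hk i)
  have hsmall : 2 * |∑ i, k i| < (p : ℤ) := by
    rw [hsum] at hbound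
    have : 2 * |((∑ i, k i : ℤ) : ℚ)| < (p : ℚ) := by linarith
    exact_mod_cast this
  have hreal : (10 : ℝ) ^ P * ((∑ i, m i : ℚ) : ℝ) = ((∑ i, k i : ℤ) : ℝ) := by
    exact_mod_cast hsum
  rw [hbroadcast, dec_intCast P hsmall, ← hreal, mul_div_cancel_left₀ _ (by positivity)]
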